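/- arXiv:2212.13278 — 2 statements merged into one kernel-verified Lean document; each statement's English description precedes it below -/
import Mathlib

section
/- Let c₁ ∈ (0,1) and c₂, c₃, η > 0, and let (a_t)_{t≥0}, (b_t)_{t≥0} be sequences of nonnegative real numbers such that for every t ≥ 0: if b_t ≤ η then a_{t+1} ≤ c₁·a_t + c₂·a_t² and b_{t+1} ≤ b_t + c₃·a_t. If a₀ ≤ min{(1−c₁)/(2c₂), η(1−c₁)/(4c₃)} and b₀ ≤ η/2, then for every t ≥ 0 one has b_t ≤ η and a_t ≤ ((1+c₁)/2)^t · a₀ (in particular a_t ≤ ε once t ≥ ⌈log(a₀/ε)/log(2/(1+c₁))⌉ for any ε > 0). -/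
/-- Sequence lemma: linear contraction up to quadratic error, with drift control. -/
theorem stmt_0 (c₁ c₂ c₃ η : ℝ) (hc₁ : 0 < c₁) (hc₁' : c₁ < 1) (hc₂ : 0 < c₂)
    (hc₃ : 0 < c₃) (hη : 0 < η) (a b : ℕ → ℝ)
    (ha_nonneg : ∀ t, 0 ≤ a t) (hb_nonneg : ∀ t, 0 ≤ b t)
    (hstep : ∀ t, b t ≤ η →
      a (t + 1) ≤ c₁ * a t + c₂ * (a t) ^ 2 ∧ b (t + 1) ≤ b t + c₃ * a t)
    (ha0 : a 0 ≤ min ((1 - c₁) / (2 * c₂)) (η * (1 - c₁) / (4 * c₃)))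
    (hb0 : b 0 ≤ η / 2) :
    (∀ t, b t ≤ η ∧ a t ≤ ((1 + c₁) / 2) ^ t * a 0) ∧
      (∀ ε : ℝ, 0 < ε → ∀ t : ℕ,
        (⌈Real.log (a 0 / ε) / Real.log (2 / (1 + c₁))⌉ ≤ (t : ℤ)) → a t ≤ ε) := by
  obtain ⟨h1, h2⟩ := le_min_iff.mp ha0
  rw [le_div_iff₀ (by positivity)] at h1 h2
  obtain ⟨r, hr⟩ : ∃ r, r = (1 + c₁) / 2 := ⟨_, rfl⟩
  have hr0 : 0 < r := by rw [hr]; linarith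
  have hr1 : r < 1 := by rw [hr]; linarith
  have ha00 := ha_nonneg 0
  have key : ∀ t, b t ≤ η - η / 2 * r ^ t ∧ a t ≤ r ^ t * a 0 := by
    intro t
    induction t with
    | zero => constructor <;> simp <;> linarith
    | succ t ih =>
      obtain ⟨hb, ha⟩ := ih
      have hp : 0 < r ^ t := pow_pos hr0 t
      have hp1 : r ^ t ≤ 1 := pow_le_one₀ hr0.le hr1.le
      have hbη : b t ≤ η := by
        have : 0 ≤ η / 2 * r ^ t := by positivity
        linarith
      obtain ⟨hA, hB⟩ := hstep t hbη
      have hat : a t ≤ a 0 := ha.trans (mul_le_of_le_one_left ha00 hp1)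
      have hca : c₂ * a t ≤ c₂ * a 0 := mul_le_mul_of_nonneg_left hat hc₂.le
      constructor
      · have e1 : c₃ * a t ≤ c₃ * (r ^ t * a 0) := mul_le_mul_of_nonneg_left ha hc₃.le
        have e2 : r ^ t * (a 0 * (4 * c₃)) ≤ r ^ t * (η * (1 - c₁)) :=
          mul_le_mul_of_nonneg_left h2 hp.le
        have e3 : η / 2 * r ^ (t + 1) = η / 2 * r ^ t - r ^ t * (η * (1 - c₁)) / 4 := by
          rw [pow_succ]; nth_rewrite 2 [hr]; ring
        linarith
      · have e1 : (c₁ + c₂ * a t) * a t ≤ r * a t := by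
          apply mul_le_mul_of_nonneg_right _ (ha_nonneg t)
          rw [hr]; linarith
        have e2 : r * a t ≤ r * (r ^ t * a 0) := mul_le_mul_of_nonneg_left ha hr0.le
        calc a (t + 1) ≤ (c₁ + c₂ * a t) * a t := by linarith
          _ ≤ r * (r ^ t * a 0) := e1.trans e2
          _ = r ^ (t + 1) * a 0 := by ring
  rw [← hr]
  refine ⟨fun t => ⟨?_, (key t).2⟩, ?_⟩
  · have : 0 ≤ η / 2 * r ^ t := by positivity
    linarith [(key t).1]
  · intro ε hε t ht
    refine (key t).2.trans ?_
    rcases ha00.eq_or_lt with h0 | h0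
    · rw [← h0]; simpa using hε.le
    have hq : 2 / (1 + c₁) = r⁻¹ := by rw [hr, inv_div]
    rw [hq, Int.ceil_le, Int.cast_natCast,
      div_le_iff₀ (Real.log_pos ((one_lt_inv₀ hr0).mpr hr1)), ← Real.log_pow,
      Real.log_le_log_iff (by positivity) (by positivity), inv_pow, div_le_iff₀ hε] at ht
    calc r ^ t * a 0 ≤ r ^ t * ((r ^ t)⁻¹ * ε) := by gcongr
      _ = ε := by field_simp
end

section
/- Let c : ℝ^d → ℝ^m be Lipschitz with constant L_c > 0 on an open neighborhood V of a point x⋆, let h : ℝ^m → ℝ, let X⋆ ⊆ ℝ^d be a set containing x⋆, and set h∗ := h(c(x⋆)) and Z⋆ := c(X⋆ ∩ V) (the image of X⋆ ∩ V under c). Suppose there is μ_f > 0 such that μ_f · dist(x, X⋆) ≤ h(c(x)) − h∗ for all x ∈ V. Then there exist μ_h > 0 and an open neighborhood W of x⋆ such that h(c(x)) − h∗ ≥ μ_h · dist(c(x), Z⋆) for all x ∈ W; in fact one may take μ_h = μ_f / L_c. -/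
/-- Sharpness of the composition implies sharpness of `h` on the image of `c`,
with constant `μ_f / L_c`. -/
theorem stmt_1 (d m : ℕ)
    (c : EuclideanSpace ℝ (Fin d) → EuclideanSpace ℝ (Fin m))
    (h : EuclideanSpace ℝ (Fin m) → ℝ)
    (xstar : EuclideanSpace ℝ (Fin d)) (Xstar V : Set (EuclideanSpace ℝ (Fin d)))
    (hV : IsOpen V) (hxV : xstar ∈ V) (hxX : xstar ∈ Xstar)
    (Lc : ℝ) (hLc : 0 < Lc)
    (hlip : ∀ x ∈ V, ∀ x' ∈ V, ‖c x - c x'‖ ≤ Lc * ‖x - x'‖)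
    (μf : ℝ) (hμf : 0 < μf)
    (hsharp : ∀ x ∈ V, μf * Metric.infDist x Xstar ≤ h (c x) - h (c xstar)) :
    ∃ W : Set (EuclideanSpace ℝ (Fin d)), IsOpen W ∧ xstar ∈ W ∧
      ∀ x ∈ W, h (c x) - h (c xstar) ≥
        (μf / Lc) * Metric.infDist (c x) (c '' (Xstar ∩ V)) := by
  obtain ⟨ε, hε, hball⟩ := Metric.isOpen_iff.1 hV xstar hxV
  refine ⟨Metric.ball xstar (ε / 2), Metric.isOpen_ball, Metric.mem_ball_self (by linarith), ?_⟩
  intro x hx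
  have hx' : dist x xstar < ε / 2 := hx
  have hxV' : x ∈ V := hball (Metric.ball_subset_ball (by linarith) hx)
  have key : Metric.infDist (c x) (c '' (Xstar ∩ V)) / Lc ≤ Metric.infDist x Xstar := by
    by_contra! hlt
    have h1 : Metric.infDist x Xstar < ε / 2 :=
      lt_of_le_of_lt (Metric.infDist_le_dist_of_mem hxX) hx'
    obtain ⟨y, hyX, hy⟩ := (Metric.infDist_lt_iff ⟨xstar, hxX⟩).1 (lt_min h1 hlt)
    have hy1 := lt_of_lt_of_le hy (min_le_left _ _)
    have hy2 := lt_of_lt_of_le hy (min_le_right _ _)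
    have hyV : y ∈ V := by
      apply hball
      have := dist_triangle y x xstar
      rw [dist_comm y x] at this
      rw [Metric.mem_ball]
      linarith
    have h2 : Metric.infDist (c x) (c '' (Xstar ∩ V)) ≤ dist (c x) (c y) :=
      Metric.infDist_le_dist_of_mem ⟨y, ⟨hyX, hyV⟩, rfl⟩
    have h3 := hlip x hxV' y hyV
    rw [← dist_eq_norm, ← dist_eq_norm] at h3
    rw [lt_div_iff₀ hLc] at hy2
    linarith
  have h4 := mul_le_mul_of_nonneg_left key hμf.le
  have h5 := hsharp x hxV'
  have h6 : μf / Lc * Metric.infDist (c x) (c '' (Xstar ∩ V))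
      = μf * (Metric.infDist (c x) (c '' (Xstar ∩ V)) / Lc) := by ring
  rw [h6]
  linarith
end
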